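/- arXiv:2503.07623 — 2 statements merged into one kernel-verified Lean document; each statement's English description precedes it below -/
import Mathlib

section
/- Let n ≥ 1 and let u : EuclideanSpace ℝ (Fin n) → ℝ be a smooth, bounded function which is exponentially harmonic, i.e. div(x ↦ exp(‖∇u(x)‖²/2) • ∇u(x)) = 0 everywhere. Then u is constant. -/
open scoped RealInnerProductSpace
open Real MeasureTheory

noncomputable def Hess {n : ℕ} (f : EuclideanSpace ℝ (Fin n) → ℝ)
    (x v w : EuclideanSpace ℝ (Fin n)) : ℝ :=
  iteratedFDeriv ℝ 2 f x ![v, w]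

noncomputable def lap {n : ℕ} (f : EuclideanSpace ℝ (Fin n) → ℝ)
    (x : EuclideanSpace ℝ (Fin n)) : ℝ :=
  ∑ i, Hess f x (EuclideanSpace.basisFun (Fin n) ℝ i) (EuclideanSpace.basisFun (Fin n) ℝ i)

noncomputable def divg {n : ℕ} (X : EuclideanSpace ℝ (Fin n) → EuclideanSpace ℝ (Fin n))
    (x : EuclideanSpace ℝ (Fin n)) : ℝ :=
  ∑ i, ⟪fderiv ℝ X x (EuclideanSpace.basisFun (Fin n) ℝ i), EuclideanSpace.basisFun (Fin n) ℝ i⟫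

/-- Second-derivative necessary condition at a local maximum on the line. -/
lemma IsLocalMax.second_deriv_nonpos {g g' : ℝ → ℝ} {c t : ℝ} (hmax : IsLocalMax g t)
    (hg : ∀ᶠ s in nhds t, HasDerivAt g (g' s) s) (hg' : HasDerivAt g' c t) : c ≤ 0 := by
  by_contra! hc
  have hd : deriv g =ᶠ[nhds t] g' := hg.mono fun s hs => hs.deriv
  have hdd : deriv (deriv g) t = c := by rw [hd.deriv_eq, hg'.deriv]
  have hmin : IsLocalMin g t :=
    isLocalMin_of_deriv_deriv_pos (by rwa [hdd]) hmax.deriv_eq_zero hg.self_of_nhds.continuousAt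
  have hconst : g =ᶠ[nhds t] fun _ => g t := by
    filter_upwards [hmax, hmin] with s h₁ h₂ using le_antisymm h₁ h₂
  have hzero : deriv (deriv g) t = 0 := by
    rw [hconst.deriv.deriv_eq]
    simp
  linarith

section LineTest

variable {E : Type*} [NormedAddCommGroup E] [InnerProductSpace ℝ E]

lemma hasDerivAt_add_smul (x a : E) (t : ℝ) : HasDerivAt (fun s : ℝ => x + s • a) a t := by
  simpa using ((hasDerivAt_id t).smul_const a).const_add x

lemma hasDerivAt_normSq_add_smul (x a : E) (t : ℝ) :
    HasDerivAt (fun s : ℝ => ‖x + s • a‖ ^ 2) (2 * ⟪x + t • a, a⟫) t :=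
  (hasDerivAt_add_smul x a t).norm_sq

lemma hasDerivAt_inner_add_smul (x a : E) (t : ℝ) :
    HasDerivAt (fun s : ℝ => ⟪x + s • a, a⟫) (‖a‖ ^ 2) t := by
  simpa using (hasDerivAt_add_smul x a t).inner ℝ (hasDerivAt_const t a)

variable [CompleteSpace E]

lemma hasDerivAt_comp_add_smul {u : E → ℝ} (hu : Differentiable ℝ u) (x a : E) (t : ℝ) :
    HasDerivAt (fun s : ℝ => u (x + s • a)) ⟪gradient u (x + t • a), a⟫ t := by
  rw [inner_gradient_left]
  exact (hu _).hasFDerivAt.comp_hasDerivAt t (hasDerivAt_add_smul x a t)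

lemma hasDerivAt_inner_gradient_add_smul {u : E → ℝ} (hu : Differentiable ℝ (gradient u))
    (x a : E) (t : ℝ) :
    HasDerivAt (fun s : ℝ => ⟪gradient u (x + s • a), a⟫)
      ⟪fderiv ℝ (gradient u) (x + t • a) a, a⟫ t := by
  simpa using ((hu _).hasFDerivAt.comp_hasDerivAt t (hasDerivAt_add_smul x a t)).inner ℝ
    (hasDerivAt_const t a)

/-- First and second order conditions at a maximum of
`u x - u y - M * ‖x - y‖ ^ (1 / 2) - ε * ‖x‖ ^ 2`, tested in the direction `(a, b)`. -/
lemma doubled_max_line_test {u : E → ℝ} (hu : Differentiable ℝ u)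
    (hu' : Differentiable ℝ (gradient u)) {M ε : ℝ} {x y : E} (hxy : x ≠ y)
    (hmax : ∀ x' y', u x' - u y' - M * (‖x' - y'‖ ^ 2) ^ (1 / 4 : ℝ) - ε * ‖x'‖ ^ 2 ≤
      u x - u y - M * (‖x - y‖ ^ 2) ^ (1 / 4 : ℝ) - ε * ‖x‖ ^ 2) (a b : E) :
    (⟪gradient u x, a⟫ - ⟪gradient u y, b⟫
      - M * (1 / 4 * (‖x - y‖ ^ 2) ^ (-3 / 4 : ℝ) * (2 * ⟪x - y, a - b⟫))
      - ε * (2 * ⟪x, a⟫) = 0) ∧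
    ⟪fderiv ℝ (gradient u) x a, a⟫ - ⟪fderiv ℝ (gradient u) y b, b⟫
      - M * (1 / 4 * ((-3 / 4 * (‖x - y‖ ^ 2) ^ (-7 / 4 : ℝ) * (2 * ⟪x - y, a - b⟫))
          * (2 * ⟪x - y, a - b⟫)
          + (‖x - y‖ ^ 2) ^ (-3 / 4 : ℝ) * (2 * ‖a - b‖ ^ 2)))
      - ε * (2 * ‖a‖ ^ 2) ≤ 0 := by
  have hz : 0 < ‖x - y + (0 : ℝ) • (a - b)‖ ^ 2 := by
    have := norm_pos_iff.mpr (sub_ne_zero.mpr hxy)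
    rw [zero_smul, add_zero]
    positivity
  have hpow : ∀ (p : ℝ) (t : ℝ), 0 < ‖x - y + t • (a - b)‖ ^ 2 →
      HasDerivAt (fun s : ℝ => (‖x - y + s • (a - b)‖ ^ 2) ^ p)
        (p * (‖x - y + t • (a - b)‖ ^ 2) ^ (p - 1) * (2 * ⟪x - y + t • (a - b), a - b⟫)) t := by
    intro p t ht
    have := (hasDerivAt_normSq_add_smul (x - y) (a - b) t).rpow_const (p := p) (Or.inl ht.ne')
    convert this using 1
    ring
  set g : ℝ → ℝ := fun t => u (x + t • a) - u (y + t • b)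
    - M * (‖x - y + t • (a - b)‖ ^ 2) ^ (1 / 4 : ℝ) - ε * ‖x + t • a‖ ^ 2 with hg
  set g' : ℝ → ℝ := fun t => ⟪gradient u (x + t • a), a⟫ - ⟪gradient u (y + t • b), b⟫
    - M * (1 / 4 * (‖x - y + t • (a - b)‖ ^ 2) ^ (-3 / 4 : ℝ)
      * (2 * ⟪x - y + t • (a - b), a - b⟫)) - ε * (2 * ⟪x + t • a, a⟫) with hg'
  have hgmax : IsLocalMax g 0 := by
    refine Filter.Eventually.of_forall fun t => ?_
    have h := hmax (x + t • a) (y + t • b)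
    have e : x + t • a - (y + t • b) = x - y + t • (a - b) := by
      rw [smul_sub]; abel
    rw [e] at h
    simpa [hg] using h
  have hderiv : ∀ t, 0 < ‖x - y + t • (a - b)‖ ^ 2 → HasDerivAt g (g' t) t := by
    intro t ht
    have hp := hpow (1 / 4) t ht
    rw [show (1 / 4 - 1 : ℝ) = -3 / 4 by norm_num] at hp
    exact (((hasDerivAt_comp_add_smul hu x a t).sub (hasDerivAt_comp_add_smul hu y b t)).sub
      (hp.const_mul M)).sub ((hasDerivAt_normSq_add_smul x a t).const_mul ε)
  have hev : ∀ᶠ t in nhds (0 : ℝ), HasDerivAt g (g' t) t := by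
    have hc : Continuous fun t : ℝ => ‖x - y + t • (a - b)‖ ^ 2 := by fun_prop
    exact (hc.continuousAt.eventually (lt_mem_nhds hz)).mono hderiv
  constructor
  · have := hgmax.hasDerivAt_eq_zero (hderiv 0 hz)
    simpa [hg'] using this
  · have hp := hpow (-3 / 4) 0 hz
    rw [show (-3 / 4 - 1 : ℝ) = -7 / 4 by norm_num] at hp
    have hs : HasDerivAt g' _ 0 :=
      (((hasDerivAt_inner_gradient_add_smul hu' x a 0).sub
        (hasDerivAt_inner_gradient_add_smul hu' y b 0)).sub
        (((hp.const_mul (1 / 4)).mul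
          ((hasDerivAt_inner_add_smul (x - y) (a - b) 0).const_mul 2)).const_mul M
          |>.congr_of_eventuallyEq (Filter.Eventually.of_forall fun t => by simp))).sub
        (((hasDerivAt_inner_add_smul x a 0).const_mul 2).const_mul ε)
    have := hgmax.second_deriv_nonpos hev hs
    simp only [zero_smul, add_zero] at this
    convert this using 3
    ring

end LineTest

lemma OrthonormalBasis.sum_inner_mul_apply {ι E : Type*} [Fintype ι] [NormedAddCommGroup E]
    [InnerProductSpace ℝ E] (e : OrthonormalBasis ι ℝ E) (L : E →L[ℝ] ℝ) (z : E) :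
    ∑ i, ⟪z, e i⟫ * L (e i) = L z := by
  conv_rhs => rw [← e.sum_repr' z]
  simp [real_inner_comm]

/-- The trace of an operator is invariant under the reflection in the hyperplane orthogonal
to `z`. -/
lemma OrthonormalBasis.sum_inner_reflection {ι E : Type*} [Fintype ι] [NormedAddCommGroup E]
    [InnerProductSpace ℝ E] (e : OrthonormalBasis ι ℝ E) (B : E →L[ℝ] E) {z : E} (hz : z ≠ 0) :
    ∑ i, ⟪B (e i - (⟪z, e i⟫ * (2 / ‖z‖ ^ 2)) • z), e i - (⟪z, e i⟫ * (2 / ‖z‖ ^ 2)) • z⟫ =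
      ∑ i, ⟪B (e i), e i⟫ := by
  have hs : ‖z‖ ^ 2 ≠ 0 := by simpa using hz
  have h₁ : ∑ i, ⟪z, e i⟫ * ⟪z, B (e i)⟫ = ⟪z, B z⟫ :=
    e.sum_inner_mul_apply ((innerSL ℝ z) ∘L B) z
  have h₂ : ∑ i, ⟪z, e i⟫ * ⟪B z, e i⟫ = ⟪B z, z⟫ := e.sum_inner_mul_apply (innerSL ℝ (B z)) z
  have h₃ : ∑ i, ⟪z, e i⟫ * ⟪z, e i⟫ = ‖z‖ ^ 2 := by
    rw [← real_inner_self_eq_norm_sq]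
    exact e.sum_inner_mul_apply (innerSL ℝ z) z
  have hterm : ∀ i, ⟪B (e i - (⟪z, e i⟫ * (2 / ‖z‖ ^ 2)) • z),
      e i - (⟪z, e i⟫ * (2 / ‖z‖ ^ 2)) • z⟫ =
      ⟪B (e i), e i⟫ - (2 / ‖z‖ ^ 2) * (⟪z, e i⟫ * ⟪z, B (e i)⟫)
        - (2 / ‖z‖ ^ 2) * (⟪z, e i⟫ * ⟪B z, e i⟫)
        + (2 / ‖z‖ ^ 2) ^ 2 * ⟪B z, z⟫ * (⟪z, e i⟫ * ⟪z, e i⟫) := by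
    intro i
    simp only [map_sub, map_smul, inner_sub_left, inner_sub_right, real_inner_smul_left,
      real_inner_smul_right, real_inner_comm z (B (e i))]
    ring
  rw [Finset.sum_congr rfl fun i _ => hterm i, Finset.sum_add_distrib, Finset.sum_sub_distrib,
    Finset.sum_sub_distrib, ← Finset.mul_sum, ← Finset.mul_sum, ← Finset.mul_sum, h₁, h₂, h₃,
    real_inner_comm z (B z)]
  field_simp
  ring

/-- The divergence of `exp (‖X‖ ^ 2 / 2) • X`, up to the exponential factor. -/
lemma divg_exp_smul {n : ℕ} {X : EuclideanSpace ℝ (Fin n) → EuclideanSpace ℝ (Fin n)}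
    (x : EuclideanSpace ℝ (Fin n)) (hX : DifferentiableAt ℝ X x) :
    divg (fun y => Real.exp (‖X y‖ ^ 2 / 2) • X y) x =
      Real.exp (‖X x‖ ^ 2 / 2) * (divg X x + ⟪fderiv ℝ X x (X x), X x⟫) := by
  have hE : HasFDerivAt (fun y => Real.exp (‖X y‖ ^ 2 / 2)) _ x :=
    ((hX.hasFDerivAt.norm_sq).mul_const (1 / 2 : ℝ) |>.congr_of_eventuallyEq
      (Filter.Eventually.of_forall fun y => by simp [div_eq_mul_inv])).exp
  have hF : HasFDerivAt (fun y => Real.exp (‖X y‖ ^ 2 / 2) • X y) _ x := hE.smul hX.hasFDerivAt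
  have hsum : ∑ i, ⟪X x, EuclideanSpace.basisFun (Fin n) ℝ i⟫ *
      ⟪X x, fderiv ℝ X x (EuclideanSpace.basisFun (Fin n) ℝ i)⟫ =
      ⟪fderiv ℝ X x (X x), X x⟫ := by
    rw [real_inner_comm]
    exact (EuclideanSpace.basisFun (Fin n) ℝ).sum_inner_mul_apply
      ((innerSL ℝ (X x)) ∘L fderiv ℝ X x) (X x)
  unfold divg
  rw [hF.fderiv, ← hsum, mul_add, Finset.mul_sum, Finset.mul_sum, ← Finset.sum_add_distrib]
  refine Finset.sum_congr rfl fun i _ => ?_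
  simp only [add_apply, smul_apply, ContinuousLinearMap.smulRight_apply, inner_add_left,
    real_inner_smul_left, ContinuousLinearMap.comp_apply, innerSL_apply_apply, smul_eq_mul,
    nsmul_eq_mul]
  push_cast
  ring

/-- For a solution of `Δu + ⟨D²u ∇u, ∇u⟩ = 0`, the quantitative information extracted at a
maximum of the doubled function by reflection coupling. -/
lemma doubled_max_estimate {n : ℕ} {u : EuclideanSpace ℝ (Fin n) → ℝ} (hu : Differentiable ℝ u)
    (hu' : Differentiable ℝ (gradient u))
    (heq : ∀ x, divg (gradient u) x + ⟪fderiv ℝ (gradient u) x (gradient u x), gradient u x⟫ = 0)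
    {M ε : ℝ} (hM : 0 ≤ M) {x y : EuclideanSpace ℝ (Fin n)} (hxy : x ≠ y)
    (hmax : ∀ x' y', u x' - u y' - M * (‖x' - y'‖ ^ 2) ^ (1 / 4 : ℝ) - ε * ‖x'‖ ^ 2 ≤
      u x - u y - M * (‖x - y‖ ^ 2) ^ (1 / 4 : ℝ) - ε * ‖x‖ ^ 2) :
    M * (‖x - y‖ ^ 2) ^ (-3 / 4 : ℝ) ≤ 2 * ε * n
      + M * (‖x - y‖ ^ 2) ^ (-3 / 4 : ℝ) / 2 * ‖(2 * ε) • x‖ ^ 2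
      + 2 * ε * ‖(M * (‖x - y‖ ^ 2) ^ (-3 / 4 : ℝ) / 2) • (x - y) + (2 * ε) • x‖ ^ 2 := by
  have htest := doubled_max_line_test hu hu' hxy hmax
  have hz : x - y ≠ 0 := sub_ne_zero.mpr hxy
  set z := x - y with hzdef
  have hs : 0 < ‖z‖ ^ 2 := by
    have := norm_pos_iff.mpr hz
    positivity
  set s := ‖z‖ ^ 2 with hsdef
  set K := s ^ (-3 / 4 : ℝ) with hK
  have hK0 : 0 < K := rpow_pos_of_pos hs _
  set J := s ^ (-7 / 4 : ℝ) with hJ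
  have hJ0 : 0 < J := rpow_pos_of_pos hs _
  have hJs : J * s = K := by
    rw [hJ, hK, ← rpow_add_one hs.ne']
    norm_num
  have hgx : gradient u x = (M * K / 2) • z + (2 * ε) • x := by
    refine ext_inner_right ℝ fun a => ?_
    have := (htest a 0).1
    simp only [inner_zero_right, sub_zero] at this
    rw [inner_add_left, real_inner_smul_left, real_inner_smul_left]
    linarith
  have hgy : gradient u y = (M * K / 2) • z := by
    refine ext_inner_right ℝ fun b => ?_
    have := (htest 0 b).1
    simp only [inner_zero_right, zero_sub, inner_neg_right] at this
    rw [real_inner_smul_left]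
    linarith
  have hgrad := (htest (gradient u x) (gradient u y)).2
  have hdiff : gradient u x - gradient u y = (2 * ε) • x := by rw [hgx, hgy]; abel
  rw [hdiff] at hgrad
  have hconc : 0 ≤ M * (J * ⟪z, (2 * ε) • x⟫ ^ 2) := by positivity
  let e := EuclideanSpace.basisFun (Fin n) ℝ
  have hsq : ∑ i, ⟪z, e i⟫ * ⟪z, e i⟫ = s := by
    rw [hsdef, ← real_inner_self_eq_norm_sq]
    exact e.sum_inner_mul_apply (innerSL ℝ z) z
  have hrefl : ∀ i, ⟪fderiv ℝ (gradient u) x (e i), e i⟫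
      - ⟪fderiv ℝ (gradient u) y (e i - (⟪z, e i⟫ * (2 / s)) • z),
          e i - (⟪z, e i⟫ * (2 / s)) • z⟫
      + M * K / s * (⟪z, e i⟫ * ⟪z, e i⟫) ≤ 2 * ε := by
    intro i
    have h := (htest (e i) (e i - (⟪z, e i⟫ * (2 / s)) • z)).2
    rw [sub_sub_cancel, real_inner_smul_right, real_inner_self_eq_norm_sq, norm_smul, mul_pow,
      ← hsdef, e.orthonormal.1 i, Real.norm_eq_abs, sq_abs, ← hJs] at h
    rw [← hJs]
    have e₁ : M * (1 / 4 * ((-3 / 4 * J * (2 * (⟪z, e i⟫ * (2 / s) * s)))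
        * (2 * (⟪z, e i⟫ * (2 / s) * s)) + J * s * (2 * ((⟪z, e i⟫ * (2 / s)) ^ 2 * s))))
        = - (M * (J * s) / s * (⟪z, e i⟫ * ⟪z, e i⟫)) := by
      field_simp
      ring
    rw [e₁] at h
    linarith
  have hsum := Finset.sum_le_sum fun i (_ : i ∈ Finset.univ) => hrefl i
  rw [Finset.sum_add_distrib, Finset.sum_sub_distrib, hsdef, e.sum_inner_reflection _ hz,
    ← Finset.mul_sum, hsq, ← hsdef] at hsum
  rw [div_mul_cancel₀ _ hs.ne'] at hsum
  simp only [Finset.sum_const, Finset.card_univ, Fintype.card_fin, nsmul_eq_mul] at hsum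
  have hx := heq x
  have hy := heq y
  unfold divg at hx hy
  rw [← hgx]
  linarith

/-- A solution with oscillation at most `D` satisfies the Hölder estimate of exponent `1 / 2`
with every positive constant. -/
lemma sub_le_mul_sqrt_dist_of_bounded {n : ℕ} {u : EuclideanSpace ℝ (Fin n) → ℝ}
    (hu : Differentiable ℝ u) (hu' : Differentiable ℝ (gradient u))
    (heq : ∀ x, divg (gradient u) x + ⟪fderiv ℝ (gradient u) x (gradient u x), gradient u x⟫ = 0)
    {D : ℝ} (hD : ∀ x y, u x - u y ≤ D) {M : ℝ} (hM : 0 < M) (x₀ y₀ : EuclideanSpace ℝ (Fin n)) :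
    u x₀ - u y₀ ≤ M * (‖x₀ - y₀‖ ^ 2) ^ (1 / 4 : ℝ) := by
  by_contra! hlt
  have hD0 : 0 ≤ D := by simpa using hD 0 0
  set L := D / M with hL
  have hL0 : 0 ≤ L := by positivity
  set T := 2 * n * L ^ 3 + 2 * M * D + M ^ 2 * L + 16 * D * L ^ 3 with hT
  obtain ⟨ε, hε, hε1, hεT, hεx⟩ : ∃ ε : ℝ, 0 < ε ∧ ε ≤ 1 ∧ ε * T < M ∧
      0 < u x₀ - u y₀ - M * (‖x₀ - y₀‖ ^ 2) ^ (1 / 4 : ℝ) - ε * ‖x₀‖ ^ 2 := by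
    have h₁ : ∀ᶠ ε in nhds (0 : ℝ), ε * T < M :=
      (by fun_prop : Continuous fun ε : ℝ => ε * T).continuousAt.eventually
        (gt_mem_nhds (by simpa using hM))
    have h₂ : ∀ᶠ ε in nhds (0 : ℝ),
        0 < u x₀ - u y₀ - M * (‖x₀ - y₀‖ ^ 2) ^ (1 / 4 : ℝ) - ε * ‖x₀‖ ^ 2 :=
      (by fun_prop : Continuous fun ε : ℝ =>
        u x₀ - u y₀ - M * (‖x₀ - y₀‖ ^ 2) ^ (1 / 4 : ℝ) - ε * ‖x₀‖ ^ 2).continuousAt.eventually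
        (lt_mem_nhds (by simpa using hlt))
    have h₃ : ∀ᶠ ε in nhds (0 : ℝ), ε ≤ 1 := eventually_le_nhds one_pos
    obtain ⟨ε, ⟨h₁, h₂, h₃⟩, h₀⟩ :=
      (((h₁.and (h₂.and h₃)).filter_mono nhdsWithin_le_nhds).and
        (self_mem_nhdsWithin (s := Set.Ioi (0 : ℝ)))).exists
    exact ⟨ε, h₀, h₃, h₁, h₂⟩
  set Φ : EuclideanSpace ℝ (Fin n) × EuclideanSpace ℝ (Fin n) → ℝ := fun w =>
    u w.1 - u w.2 - M * (‖w.1 - w.2‖ ^ 2) ^ (1 / 4 : ℝ) - ε * ‖w.1‖ ^ 2 with hΦ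
  have hΦc : Continuous Φ := by
    have hc : Continuous fun w : EuclideanSpace ℝ (Fin n) × EuclideanSpace ℝ (Fin n) =>
        (‖w.1 - w.2‖ ^ 2) ^ (1 / 4 : ℝ) :=
      Continuous.rpow_const (by fun_prop) fun _ => Or.inr (by norm_num)
    have := hu.continuous
    fun_prop
  have hbound : ∀ w, 0 ≤ Φ w → (‖w.1 - w.2‖ ^ 2) ^ (1 / 4 : ℝ) ≤ L ∧ ε * ‖w.1‖ ^ 2 ≤ D := by
    intro w hw
    have h := hD w.1 w.2
    have h₁ : 0 ≤ (‖w.1 - w.2‖ ^ 2) ^ (1 / 4 : ℝ) := by positivity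
    have h₂ : 0 ≤ M * (‖w.1 - w.2‖ ^ 2) ^ (1 / 4 : ℝ) := by positivity
    have h₃ : 0 ≤ ε * ‖w.1‖ ^ 2 := by positivity
    simp only [hΦ] at hw
    refine ⟨?_, by linarith⟩
    rw [hL, le_div_iff₀ hM]
    linarith
  have hroot : ∀ z : EuclideanSpace ℝ (Fin n), ((‖z‖ ^ 2) ^ (1 / 4 : ℝ)) ^ 4 = ‖z‖ ^ 2 := by
    intro z
    rw [← rpow_natCast, ← rpow_mul (by positivity)]
    norm_num
  have hcompact : IsCompact {w | 0 ≤ Φ w} := by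
    refine Metric.isCompact_of_isClosed_isBounded (isClosed_le continuous_const hΦc) ?_
    refine (Metric.isBounded_closedBall (x := 0)
      (r := (1 + D / ε) + (1 + L ^ 4))).subset fun w hw => ?_
    obtain ⟨h₁, h₂⟩ := hbound w hw
    have h₃ : ‖w.1‖ ^ 2 ≤ D / ε := by
      rw [le_div_iff₀ hε]
      linarith
    have h₄ : ‖w.1 - w.2‖ ^ 2 ≤ L ^ 4 := by
      rw [← hroot]
      gcongr
    have h₅ : ‖w.1‖ ≤ 1 + D / ε := by nlinarith [sq_nonneg (‖w.1‖ - 1)]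
    have h₆ : ‖w.1 - w.2‖ ≤ 1 + L ^ 4 := by nlinarith [sq_nonneg (‖w.1 - w.2‖ - 1)]
    have h₇ : ‖w.2‖ ≤ ‖w.1‖ + ‖w.1 - w.2‖ := norm_le_norm_add_norm_sub _ _
    have h₈ : 0 ≤ L ^ 4 := by positivity
    rw [mem_closedBall_zero_iff, Prod.norm_def]
    exact max_le (by linarith) (by linarith)
  obtain ⟨⟨x, y⟩, hxy0, hmaxOn⟩ :=
    hcompact.exists_isMaxOn ⟨(x₀, y₀), hεx.le⟩ hΦc.continuousOn
  have hpos : 0 < Φ (x, y) := hεx.trans_le (hmaxOn (show (x₀, y₀) ∈ {w | 0 ≤ Φ w} from hεx.le))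
  have hmax : ∀ x' y', Φ (x', y') ≤ Φ (x, y) := by
    intro x' y'
    by_cases h : 0 ≤ Φ (x', y')
    · exact hmaxOn h
    · linarith
  have hne : x ≠ y := by
    rintro rfl
    have : 0 ≤ ε * ‖x‖ ^ 2 := by positivity
    simp [hΦ] at hpos
    linarith
  have hest := doubled_max_estimate hu hu' heq hM.le hne hmax
  obtain ⟨hρL, hxD⟩ := hbound (x, y) hpos.le
  have hs : 0 < ‖x - y‖ ^ 2 := by
    have := norm_pos_iff.mpr (sub_ne_zero.mpr hne)
    positivity
  simp only at hρL hxD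
  have hρ4 := hroot (x - y)
  have hK : (‖x - y‖ ^ 2) ^ (-3 / 4 : ℝ) * ((‖x - y‖ ^ 2) ^ (1 / 4 : ℝ)) ^ 3 = 1 := by
    rw [← rpow_mul_natCast hs.le, ← rpow_add hs]
    norm_num
  have hρ : 0 < (‖x - y‖ ^ 2) ^ (1 / 4 : ℝ) := rpow_pos_of_pos hs _
  have hK0 : 0 < (‖x - y‖ ^ 2) ^ (-3 / 4 : ℝ) := rpow_pos_of_pos hs _
  set K := (‖x - y‖ ^ 2) ^ (-3 / 4 : ℝ)
  set ρ := (‖x - y‖ ^ 2) ^ (1 / 4 : ℝ)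
  have hq : ‖(M * K / 2) • (x - y) + (2 * ε) • x‖ ^ 2 ≤
      2 * ((M * K / 2) ^ 2 * ρ ^ 4) + 2 * ‖(2 * ε) • x‖ ^ 2 := by
    have h := parallelogram_law_with_norm ℝ ((M * K / 2) • (x - y)) ((2 * ε) • x)
    have h' : ‖(M * K / 2) • (x - y)‖ ^ 2 = (M * K / 2) ^ 2 * ρ ^ 4 := by
      rw [norm_smul, mul_pow, Real.norm_eq_abs, sq_abs, hρ4]
    rw [← h']
    nlinarith [sq_nonneg ‖(M * K / 2) • (x - y) - (2 * ε) • x‖]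
  have hδ : ‖(2 * ε) • x‖ ^ 2 ≤ 4 * ε * D := by
    rw [norm_smul, mul_pow, Real.norm_eq_abs, sq_abs]
    nlinarith
  have hδ' : ‖(2 * ε) • x‖ ^ 2 ≤ 4 * D := hδ.trans (by nlinarith)
  have hfinal : M ≤ ε * T := by
    have hρ3 : ρ ^ 3 ≤ L ^ 3 := by gcongr
    calc M = M * K * ρ ^ 3 := by rw [mul_assoc, hK, mul_one]
      _ ≤ (2 * ε * n + M * K / 2 * (4 * ε * D)
          + 2 * ε * (2 * ((M * K / 2) ^ 2 * ρ ^ 4) + 2 * (4 * D))) * ρ ^ 3 := by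
        gcongr
        refine hest.trans ?_
        gcongr
        exact hq.trans (by gcongr)
      _ = ε * (2 * n * ρ ^ 3 + 2 * M * D * (K * ρ ^ 3) + M ^ 2 * ρ * (K * ρ ^ 3) ^ 2
          + 16 * D * ρ ^ 3) := by ring
      _ ≤ ε * T := by
        rw [hK, hT, one_pow, mul_one, mul_one]
        gcongr
  linarith

/-- Liouville theorem for bounded smooth exponentially harmonic functions on
Euclidean space: any bounded smooth solution of
`div (exp(‖∇u‖²/2) • ∇u) = 0` is constant. -/
theorem stmt_0 {n : ℕ} (hn : 1 ≤ n) (u : EuclideanSpace ℝ (Fin n) → ℝ)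
    (hu : ContDiff ℝ (⊤ : ℕ∞) u)
    (hbd : ∃ C : ℝ, ∀ x, |u x| ≤ C)
    (hharm : ∀ x, divg (fun y => Real.exp (‖gradient u y‖ ^ 2 / 2) • gradient u y) x = 0) :
    ∃ c : ℝ, ∀ x, u x = c := by
  obtain ⟨C, hC⟩ := hbd
  have hd : Differentiable ℝ u := hu.differentiable (by simp)
  have hd' : Differentiable ℝ (gradient u) :=
    let toE := (InnerProductSpace.toDual ℝ (EuclideanSpace ℝ (Fin n))).symm
    toE.toContinuousLinearEquiv.differentiable.comp
      (((contDiff_infty.1 hu 2).fderiv_right (m := 1) (by norm_num)).differentiable one_ne_zero)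
  have heq : ∀ x, divg (gradient u) x +
      ⟪fderiv ℝ (gradient u) x (gradient u x), gradient u x⟫ = 0 := by
    intro x
    have h := hharm x
    rw [divg_exp_smul x (hd' x)] at h
    exact (mul_eq_zero.mp h).resolve_left (Real.exp_pos _).ne'
  have hD : ∀ x y, u x - u y ≤ 2 * C := fun x y => by
    linarith [(abs_le.mp (hC x)).2, (abs_le.mp (hC y)).1]
  have hle : ∀ x y, u x ≤ u y := by
    intro x y
    have hlim : Filter.Tendsto (fun M : ℝ => M * (‖x - y‖ ^ 2) ^ (1 / 4 : ℝ))
        (nhdsWithin 0 (Set.Ioi 0)) (nhds 0) := by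
      have hc : Continuous fun M : ℝ => M * (‖x - y‖ ^ 2) ^ (1 / 4 : ℝ) := by fun_prop
      simpa using (hc.tendsto 0).mono_left nhdsWithin_le_nhds
    have := ge_of_tendsto hlim (eventually_nhdsWithin_of_forall fun M hM =>
      sub_le_mul_sqrt_dist_of_bounded hd hd' heq hD hM x y)
    linarith
  exact ⟨u 0, fun x => le_antisymm (hle x 0) (hle 0 x)⟩
end

section
/- Let u : EuclideanSpace ℝ (Fin n) → ℝ be a smooth function satisfying Δu(x) + Hess u(x)(∇u(x), ∇u(x)) = 0 for all x (exponential harmonicity), and let b > 0 satisfy 3 u(x)² < b² for all x. Then there exists a constant C > 0 (depending only on n, b, and sup |u|) such that for every a ≥ 1 and every x with ‖x‖ ≤ a: (a² − ‖x‖²)² ‖∇u(x)‖² ≤ C (b² − u(x)²) a^{7/2}. -/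
open scoped RealInnerProductSpace
open Real MeasureTheory

/-- First and second derivative tests at a local maximum. -/
theorem IsLocalMax.deriv_eq_zero_and_second_nonpos {f f' : ℝ → ℝ} {t c : ℝ}
    (hmax : IsLocalMax f t) (hf : ∀ s, HasDerivAt f (f' s) s) (hf' : HasDerivAt f' c t) :
    f' t = 0 ∧ c ≤ 0 := by
  have h0 : f' t = 0 := hmax.hasDerivAt_eq_zero (hf t)
  refine ⟨h0, ?_⟩
  by_contra! hc
  have hd : deriv f = f' := funext fun s => (hf s).deriv
  have hmin : IsLocalMin f t := by
    apply isLocalMin_of_deriv_deriv_pos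
    · rw [hd, hf'.deriv]; exact hc
    · rw [hd]; exact h0
    · exact (hf t).continuousAt
  have hconst : f =ᶠ[nhds t] fun _ => f t := by
    filter_upwards [hmax, hmin] with s h1 h2 using le_antisymm h1 h2
  have hz : f' =ᶠ[nhds t] fun _ => 0 := by
    rw [← hd]
    filter_upwards [hconst.deriv] with s hs
    rw [hs]; simp
  have := hf'.unique ((hasDerivAt_const t (0 : ℝ)).congr_of_eventuallyEq hz)
  linarith

/-- Absorption of the error terms in the differential inequality at a maximum point. -/
theorem gradient_bound_absorption {b u φ E y R n : ℝ} (hb : 0 < b) (hub : 3 * u ^ 2 < b ^ 2)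
    (hφ : 0 < φ) (hE : 0 < E) (hy : y ^ 2 ≤ R * E) (hR : 0 ≤ R) {s : ℝ}
    (hs : s * (b ^ 2 - u ^ 2) = φ * u)
    (h : 8 * R + 8 * y ^ 2 - 4 * φ * n - 4 * φ * E - 16 * (2 * R - s * y)
      - 16 * y * (2 * y - s * E) - 2 * E * (4 * R - 4 * s * y + s ^ 2 * E)
      + 2 * (φ ^ 2 / (b ^ 2 - u ^ 2)) * (E + E ^ 2) ≤ 0) :
    φ ^ 2 * E ^ 2 ≤ 3 * b ^ 2 * (40 * R + 4 * φ * n + 4 * φ * E + 356 * R * E) := by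
  obtain ⟨w, hw⟩ : ∃ w, w = b ^ 2 - u ^ 2 := ⟨_, rfl⟩
  rw [← hw] at h hs
  have hw0 : 0 < w := by nlinarith [sq_nonneg u]
  have hs' : s = φ * u / w := by field_simp; linarith
  have hsy : -(16 * R) ≤ 16 * s * y + 2 * (φ ^ 2 / w) * E := by
    have h1 : 0 ≤ 2 * φ ^ 2 * E + 16 * φ * u * y + 32 * u ^ 2 * R := by
      refine nonneg_of_mul_nonneg_left (b := E) ?_ hE
      nlinarith [sq_nonneg (φ * E + 4 * u * y), mul_le_mul_of_nonneg_left hy (sq_nonneg u)]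
    have h2 : 16 * s * y + 2 * (φ ^ 2 / w) * E = (16 * φ * u * y + 2 * φ ^ 2 * E) / w := by
      rw [hs']; field_simp
    rw [h2, le_div_iff₀ hw0]
    nlinarith [mul_le_mul_of_nonneg_right (show 2 * u ^ 2 ≤ w by linarith) hR]
  have hsE : -(4 / 9 * s ^ 2 * E ^ 2) - 324 * y ^ 2 ≤ 24 * s * y * E := by
    nlinarith [sq_nonneg (2 / 3 * s * E + 18 * y)]
  have hmain : φ ^ 2 * E ^ 2 / (3 * b ^ 2) ≤
      2 * (φ ^ 2 / w) * E ^ 2 - 22 / 9 * s ^ 2 * E ^ 2 := by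
    have h3 : 2 * (φ ^ 2 / w) * E ^ 2 - 22 / 9 * s ^ 2 * E ^ 2 =
        φ ^ 2 * E ^ 2 * ((2 * w - 22 / 9 * u ^ 2) / w ^ 2) := by
      rw [hs']; field_simp
    rw [h3, div_eq_mul_one_div]
    refine mul_le_mul_of_nonneg_left ?_ (by positivity)
    rw [div_le_div_iff₀ (by positivity) (by positivity)]
    have : w ≤ b ^ 2 := by nlinarith [sq_nonneg u]
    have : w ^ 2 ≤ b ^ 2 * b ^ 2 := by nlinarith
    nlinarith [sq_nonneg b, mul_le_mul_of_nonneg_left hub.le (sq_nonneg b)]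
  have hfin : φ ^ 2 * E ^ 2 / (3 * b ^ 2) ≤ 40 * R + 4 * φ * n + 4 * φ * E + 356 * R * E := by
    nlinarith
  rw [div_le_iff₀ (by positivity)] at hfin
  linarith

/-- Growth bound for `G = φ² E` from the absorbed inequality on a ball of radius `a ≥ 1`. -/
theorem cutoff_gradient_growth {a b φ E R m : ℝ} (ha : 1 ≤ a) (hm : 0 ≤ m) (hφ : 0 ≤ φ)
    (hE : 0 ≤ E) (hR : 0 ≤ R) (hφR : φ + R = a ^ 2)
    (h : φ ^ 2 * E ^ 2 ≤ 3 * b ^ 2 * (40 * R + 4 * φ * m + 4 * φ * E + 356 * R * E)) :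
    φ ^ 2 * E ≤ (1 + 3 * b ^ 2 * (400 + 4 * m)) * a ^ 3 := by
  obtain ⟨G, hG⟩ : ∃ G, G = φ ^ 2 * E := ⟨_, rfl⟩
  have hG0 : 0 ≤ G := by rw [hG]; positivity
  have hφa : φ ≤ a ^ 2 := by linarith
  have hRa : R ≤ a ^ 2 := by linarith
  have hφ4 : φ ^ 2 ≤ a ^ 4 := by
    calc φ ^ 2 ≤ (a ^ 2) ^ 2 := by gcongr
      _ = a ^ 4 := by ring
  have hsq : G ^ 2 ≤ 3 * b ^ 2 * ((40 + 4 * m) * a ^ 6 + 360 * a ^ 2 * G) := by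
    calc G ^ 2 = φ ^ 2 * (φ ^ 2 * E ^ 2) := by rw [hG]; ring
      _ ≤ φ ^ 2 * (3 * b ^ 2 * (40 * R + 4 * φ * m + 4 * φ * E + 356 * R * E)) := by gcongr
      _ = 3 * b ^ 2 * (φ ^ 2 * (40 * R + 4 * φ * m) + (4 * φ + 356 * R) * G) := by
        rw [hG]; ring
      _ ≤ 3 * b ^ 2 * (a ^ 4 * (40 * a ^ 2 + 4 * a ^ 2 * m) + (4 * a ^ 2 + 356 * a ^ 2) * G) := by
        gcongr
      _ = 3 * b ^ 2 * ((40 + 4 * m) * a ^ 6 + 360 * a ^ 2 * G) := by ring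
  rw [← hG]
  by_contra! hlt
  have ha3 : 0 < a ^ 3 := by positivity
  have hK : 0 ≤ 3 * b ^ 2 * (400 + 4 * m) := by positivity
  have haG : a ^ 3 ≤ G := by nlinarith
  have h6 : a ^ 6 ≤ a ^ 3 * G := by nlinarith
  have h2 : a ^ 2 * G ≤ a ^ 3 * G := by
    have : a ^ 2 ≤ a ^ 3 := pow_le_pow_right₀ ha (by norm_num)
    gcongr
  have hlast : G * G ≤ 3 * b ^ 2 * (400 + 4 * m) * a ^ 3 * G := by
    calc G * G = G ^ 2 := by ring
      _ ≤ 3 * b ^ 2 * ((40 + 4 * m) * a ^ 6 + 360 * (a ^ 2 * G)) := by linarith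
      _ ≤ 3 * b ^ 2 * ((40 + 4 * m) * (a ^ 3 * G) + 360 * (a ^ 3 * G)) := by gcongr
      _ = 3 * b ^ 2 * (400 + 4 * m) * a ^ 3 * G := by ring
  have := le_of_mul_le_mul_right hlast (ha3.trans_le haG)
  linarith

theorem hasDerivAt_comp_line {E F : Type*} [NormedAddCommGroup E] [NormedSpace ℝ E]
    [NormedAddCommGroup F] [NormedSpace ℝ F] {f : E → F} (hf : Differentiable ℝ f) (x v : E) (t : ℝ) :
    HasDerivAt (fun s : ℝ => f (x + s • v)) (fderiv ℝ f (x + t • v) v) t := by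
  have hl : HasDerivAt (fun s : ℝ => x + s • v) v t := by
    simpa using ((hasDerivAt_id t).smul_const v).const_add x
  exact (hf (x + t • v)).hasFDerivAt.comp_hasDerivAt t hl

section Gradient

variable {E : Type*} [NormedAddCommGroup E] [InnerProductSpace ℝ E] [CompleteSpace E]

theorem inner_gradient_eq_fderiv (u : E → ℝ) (x v : E) : ⟪gradient u x, v⟫ = fderiv ℝ u x v := by
  simp [gradient]

theorem ContDiff.gradient_top {u : E → ℝ} (hu : ContDiff ℝ (⊤ : ℕ∞) u) :
    ContDiff ℝ (⊤ : ℕ∞) (gradient u) := by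
  have h : ContDiff ℝ (⊤ : ℕ∞) (fderiv ℝ u) := hu.fderiv_right (by simp)
  exact (InnerProductSpace.toDual ℝ E).symm.contDiff.comp h

theorem inner_fderiv_gradient {u : E → ℝ} (hu : ContDiff ℝ (⊤ : ℕ∞) u) (x v w : E) :
    ⟪fderiv ℝ (gradient u) x v, w⟫ = iteratedFDeriv ℝ 2 u x ![v, w] := by
  have hG : DifferentiableAt ℝ (gradient u) x := hu.gradient_top.differentiable (by simp) x
  have hD : DifferentiableAt ℝ (fderiv ℝ u) x :=
    (hu.fderiv_right (m := (⊤ : ℕ∞)) (by simp)).differentiable (by simp) x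
  have h1 : HasFDerivAt (fun y => ⟪gradient u y, w⟫)
      ((innerSL ℝ w).comp (fderiv ℝ (gradient u) x)) x := by
    have := (innerSL ℝ w).hasFDerivAt.comp x hG.hasFDerivAt
    refine this.congr_of_eventuallyEq (Filter.Eventually.of_forall fun y => ?_)
    simp
  have h2 : HasFDerivAt (fun y => ⟪gradient u y, w⟫)
      ((ContinuousLinearMap.apply ℝ ℝ w).comp (fderiv ℝ (fderiv ℝ u) x)) x := by
    have := (ContinuousLinearMap.apply ℝ ℝ w).hasFDerivAt.comp x hD.hasFDerivAt
    refine this.congr_of_eventuallyEq (Filter.Eventually.of_forall fun y => ?_)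
    simp
  have h := congrArg (fun L => L v) (h1.unique h2)
  simp only [ContinuousLinearMap.comp_apply, innerSL_apply_apply,
    ContinuousLinearMap.apply_apply] at h
  rw [real_inner_comm, h, iteratedFDeriv_two_apply]
  simp

theorem inner_fderiv_gradient_symm {u : E → ℝ} (hu : ContDiff ℝ (⊤ : ℕ∞) u) (x v w : E) :
    ⟪fderiv ℝ (gradient u) x v, w⟫ = ⟪fderiv ℝ (gradient u) x w, v⟫ := by
  rw [inner_fderiv_gradient hu, inner_fderiv_gradient hu, iteratedFDeriv_two_apply,
    iteratedFDeriv_two_apply]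
  have hs : IsSymmSndFDerivAt ℝ u x :=
    (hu.contDiffAt (x := x)).isSymmSndFDerivAt
      (by simpa using WithTop.coe_le_coe.2 (le_top (a := (2 : ℕ∞))))
  simpa using hs v w

theorem differentiable_fderiv_gradient {u : E → ℝ} (hu : ContDiff ℝ (⊤ : ℕ∞) u) :
    Differentiable ℝ (fderiv ℝ (gradient u)) :=
  (hu.gradient_top.fderiv_right (m := (⊤ : ℕ∞)) (by simp)).differentiable (by simp)

theorem hasDerivAt_fderiv_gradient_line {u : E → ℝ} (hu : ContDiff ℝ (⊤ : ℕ∞) u)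
    (x v w : E) (t : ℝ) :
    HasDerivAt (fun s : ℝ => fderiv ℝ (gradient u) (x + s • v) w)
      (fderiv ℝ (fderiv ℝ (gradient u)) (x + t • v) v w) t :=
  (hasDerivAt_comp_line (differentiable_fderiv_gradient hu) x v t).clm_apply
    (hasDerivAt_const t w) |>.congr_deriv (by simp)

/-- The third derivative of `u` is symmetric under exchanging the first and last arguments. -/
theorem inner_fderiv_fderiv_gradient_swap {u : E → ℝ} (hu : ContDiff ℝ (⊤ : ℕ∞) u) (x v w : E) :
    ⟪fderiv ℝ (fderiv ℝ (gradient u)) x v v, w⟫ =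
      ⟪fderiv ℝ (fderiv ℝ (gradient u)) x w v, v⟫ := by
  have hs : IsSymmSndFDerivAt ℝ (gradient u) x :=
    (hu.gradient_top.contDiffAt (x := x)).isSymmSndFDerivAt
      (by simpa using WithTop.coe_le_coe.2 (le_top (a := (2 : ℕ∞))))
  have h1 := (hasDerivAt_fderiv_gradient_line hu x v v 0).inner ℝ (hasDerivAt_const (0 : ℝ) w)
  have h2 := (hasDerivAt_fderiv_gradient_line hu x v w 0).inner ℝ (hasDerivAt_const (0 : ℝ) v)
  have he : (fun s : ℝ => ⟪fderiv ℝ (gradient u) (x + s • v) v, w⟫) =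
      fun s : ℝ => ⟪fderiv ℝ (gradient u) (x + s • v) w, v⟫ :=
    funext fun s => inner_fderiv_gradient_symm hu _ _ _
  rw [he] at h1
  have h := h1.unique h2
  simp only [inner_zero_right, zero_smul, add_zero, zero_add] at h
  rw [h, hs v w]

/-- First and second derivative tests along a line for
`(a² − ‖x‖²)² ‖∇u‖² − M (b² − u²)`. -/
theorem isLocalMax_line_conditions {u : E → ℝ} (hu : ContDiff ℝ (⊤ : ℕ∞) u) {a b M : ℝ} {x : E}
    (hmax : IsLocalMax (fun y => (a ^ 2 - ‖y‖ ^ 2) ^ 2 * ‖gradient u y‖ ^ 2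
      - M * (b ^ 2 - u y ^ 2)) x) (v : E) :
    -4 * (a ^ 2 - ‖x‖ ^ 2) * ⟪x, v⟫ * ‖gradient u x‖ ^ 2
      + 2 * (a ^ 2 - ‖x‖ ^ 2) ^ 2 * ⟪gradient u x, fderiv ℝ (gradient u) x v⟫
      + 2 * M * u x * ⟪gradient u x, v⟫ = 0 ∧
    (8 * ⟪x, v⟫ ^ 2 - 4 * (a ^ 2 - ‖x‖ ^ 2) * ‖v‖ ^ 2) * ‖gradient u x‖ ^ 2
      - 16 * (a ^ 2 - ‖x‖ ^ 2) * (⟪x, v⟫ * ⟪gradient u x, fderiv ℝ (gradient u) x v⟫)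
      + 2 * (a ^ 2 - ‖x‖ ^ 2) ^ 2 * (‖fderiv ℝ (gradient u) x v‖ ^ 2
        + ⟪gradient u x, fderiv ℝ (fderiv ℝ (gradient u)) x v v⟫)
      + 2 * M * (⟪gradient u x, v⟫ ^ 2 + u x * ⟪fderiv ℝ (gradient u) x v, v⟫) ≤ 0 := by
  have hl : ∀ t : ℝ, HasDerivAt (fun s : ℝ => x + s • v) v t := fun t => by
    simpa using ((hasDerivAt_id t).smul_const v).const_add x
  have hG := hasDerivAt_comp_line (hu.gradient_top.differentiable (by simp)) x v
  have hA := hasDerivAt_fderiv_gradient_line hu x v v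
  have hU : ∀ t : ℝ, HasDerivAt (fun s : ℝ => u (x + s • v)) ⟪gradient u (x + t • v), v⟫ t :=
    fun t => by
      rw [inner_gradient_eq_fderiv]
      exact hasDerivAt_comp_line (hu.differentiable (by simp)) x v t
  have hφ : ∀ t : ℝ, HasDerivAt (fun s : ℝ => a ^ 2 - ‖x + s • v‖ ^ 2)
      (-(2 * ⟪x + t • v, v⟫)) t := fun t => by
    simpa using (hl t).norm_sq.const_sub (a ^ 2)
  have hf := fun t : ℝ => (((hφ t).pow 2).mul (hG t).norm_sq).sub
    ((((hU t).pow 2).const_sub (b ^ 2)).const_mul M)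
  have hline : Filter.Tendsto (fun s : ℝ => x + s • v) (nhds 0) (nhds x) := by
    simpa using (hl 0).continuousAt.tendsto
  have hmax' : IsLocalMax (fun s : ℝ => (a ^ 2 - ‖x + s • v‖ ^ 2) ^ 2 *
      ‖gradient u (x + s • v)‖ ^ 2 - M * (b ^ 2 - u (x + s • v) ^ 2)) 0 := by
    filter_upwards [hline.eventually hmax] with s hs
    simpa using hs
  have hφ' := (((hl 0).inner ℝ (hasDerivAt_const (0 : ℝ) v)).const_mul 2).neg
  have he' := ((hG 0).inner ℝ (hA 0)).const_mul 2
  have hU' := (hG 0).inner ℝ (hasDerivAt_const (0 : ℝ) v)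
  have hf' := ((((((hφ 0).pow 1).const_mul (2 : ℝ)).mul hφ').mul (hG 0).norm_sq).add
    (((hφ 0).pow 2).mul he')).sub
    ((((((hU 0).pow 1).const_mul (2 : ℝ)).mul hU').neg).const_mul M)
  have hboth := IsLocalMax.deriv_eq_zero_and_second_nonpos
    (f' := fun t => 2 * (a ^ 2 - ‖x + t • v‖ ^ 2) ^ 1 * (-(2 * ⟪x + t • v, v⟫)) *
        ‖gradient u (x + t • v)‖ ^ 2 + (a ^ 2 - ‖x + t • v‖ ^ 2) ^ 2 *
        (2 * ⟪gradient u (x + t • v), fderiv ℝ (gradient u) (x + t • v) v⟫)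
        - M * (-(2 * u (x + t • v) ^ 1 * ⟪gradient u (x + t • v), v⟫)))
    hmax' (fun t => (hf t).congr_deriv (by simp)) hf'
  obtain ⟨h1, h2⟩ := hboth
  simp only [zero_smul, add_zero, pow_one, inner_zero_right, zero_add,
    real_inner_self_eq_norm_sq, Nat.cast_ofNat, Nat.cast_one, Pi.mul_apply, Pi.neg_apply,
    Pi.pow_apply, Nat.sub_self, pow_zero, Nat.add_one_sub_one] at h1 h2
  constructor
  · linarith
  · linarith

section Basis

variable {ι : Type*} [Fintype ι] (e : OrthonormalBasis ι ℝ E)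

/-- Derivative of the equation of exponential harmonicity in the direction of the gradient. -/
theorem exponentially_harmonic_derivative {u : E → ℝ} (hu : ContDiff ℝ (⊤ : ℕ∞) u)
    (hharm : ∀ x, ∑ i, ⟪fderiv ℝ (gradient u) x (e i), e i⟫
      + ⟪fderiv ℝ (gradient u) x (gradient u x), gradient u x⟫ = 0) (x : E) :
    ∑ i, ⟪gradient u x, fderiv ℝ (fderiv ℝ (gradient u)) x (e i) (e i)⟫
      + ⟪gradient u x, fderiv ℝ (fderiv ℝ (gradient u)) x (gradient u x) (gradient u x)⟫
      = -2 * ‖fderiv ℝ (gradient u) x (gradient u x)‖ ^ 2 := by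
  set p := gradient u x with hp
  have hG := hasDerivAt_comp_line (hu.gradient_top.differentiable (by simp)) x p 0
  have hA := hasDerivAt_comp_line (differentiable_fderiv_gradient hu) x p 0
  have hsum : HasDerivAt (fun s : ℝ => ∑ i, ⟪fderiv ℝ (gradient u) (x + s • p) (e i), e i⟫)
      (∑ i, (⟪fderiv ℝ (gradient u) (x + (0 : ℝ) • p) (e i), 0⟫
        + ⟪fderiv ℝ (fderiv ℝ (gradient u)) (x + (0 : ℝ) • p) p (e i), e i⟫)) 0 :=
    HasDerivAt.fun_sum fun i _ =>
      (hasDerivAt_fderiv_gradient_line hu x p (e i) 0).inner ℝ (hasDerivAt_const (0 : ℝ) (e i))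
  have htot := hsum.add ((hA.clm_apply hG).inner ℝ hG)
  have hzero : HasDerivAt (fun s : ℝ => ∑ i, ⟪fderiv ℝ (gradient u) (x + s • p) (e i), e i⟫
      + ⟪fderiv ℝ (gradient u) (x + s • p) (gradient u (x + s • p)), gradient u (x + s • p)⟫)
      0 0 := by
    simp only [hharm]
    exact hasDerivAt_const _ _
  have h := htot.unique hzero
  simp only [zero_smul, add_zero, inner_zero_right, zero_add, ← hp, inner_add_left,
    real_inner_self_eq_norm_sq] at h
  rw [inner_fderiv_gradient_symm hu x (fderiv ℝ (gradient u) x p) p,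
    real_inner_self_eq_norm_sq] at h
  have hswap : ∀ i, ⟪p, fderiv ℝ (fderiv ℝ (gradient u)) x (e i) (e i)⟫ =
      ⟪fderiv ℝ (fderiv ℝ (gradient u)) x p (e i), e i⟫ := fun i => by
    rw [real_inner_comm, inner_fderiv_fderiv_gradient_swap hu]
  simp only [hswap]
  rw [real_inner_comm]
  linarith

/-- The gradient bound at a local maximum of `(a² − ‖x‖²)² ‖∇u‖² − M (b² − u²)` at which this
function vanishes. -/
theorem gradient_bound_of_isLocalMax {u : E → ℝ} (hu : ContDiff ℝ (⊤ : ℕ∞) u)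
    (hharm : ∀ x, ∑ i, ⟪fderiv ℝ (gradient u) x (e i), e i⟫
      + ⟪fderiv ℝ (gradient u) x (gradient u x), gradient u x⟫ = 0) {a b M : ℝ} {x : E}
    (hb : 0 < b) (hub : 3 * u x ^ 2 < b ^ 2)
    (hx : 0 < a ^ 2 - ‖x‖ ^ 2) (hgrad : 0 < ‖gradient u x‖)
    (hM : M * (b ^ 2 - u x ^ 2) = (a ^ 2 - ‖x‖ ^ 2) ^ 2 * ‖gradient u x‖ ^ 2)
    (hmax : IsLocalMax (fun y => (a ^ 2 - ‖y‖ ^ 2) ^ 2 * ‖gradient u y‖ ^ 2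
      - M * (b ^ 2 - u y ^ 2)) x) :
    (a ^ 2 - ‖x‖ ^ 2) ^ 2 * (‖gradient u x‖ ^ 2) ^ 2 ≤ 3 * b ^ 2 * (40 * ‖x‖ ^ 2
      + 4 * (a ^ 2 - ‖x‖ ^ 2) * Fintype.card ι + 4 * (a ^ 2 - ‖x‖ ^ 2) * ‖gradient u x‖ ^ 2
      + 356 * ‖x‖ ^ 2 * ‖gradient u x‖ ^ 2) := by
  have hcond := isLocalMax_line_conditions hu hmax
  have hT := exponentially_harmonic_derivative e hu hharm x
  have hH := hharm x
  have hsymm : ∀ v, ⟪gradient u x, fderiv ℝ (gradient u) x v⟫ =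
      ⟪v, fderiv ℝ (gradient u) x (gradient u x)⟫ := fun v => by
    rw [real_inner_comm, inner_fderiv_gradient_symm hu, real_inner_comm]
  simp only [hsymm] at hcond
  have hA : 0 ≤ ∑ i, ‖fderiv ℝ (gradient u) x (e i)‖ ^ 2 := by positivity
  have hy : ⟪x, gradient u x⟫ ^ 2 ≤ ‖x‖ ^ 2 * ‖gradient u x‖ ^ 2 := by
    rw [← mul_pow]
    exact sq_le_sq' (neg_le_of_abs_le (abs_real_inner_le_norm _ _)) (real_inner_le_norm _ _)
  have hE : 0 < ‖gradient u x‖ ^ 2 := by positivity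
  set p := gradient u x
  set q := fderiv ℝ (gradient u) x p with hq
  have h1 := (hcond x).1
  have h2 := (hcond p).1
  have h3 := (hcond q).1
  have h4 := (hcond p).2
  have h5 := Finset.sum_nonpos fun i (_ : i ∈ Finset.univ) => (hcond (e i)).2
  simp only [Finset.sum_add_distrib, Finset.sum_sub_distrib, ← Finset.mul_sum,
    ← Finset.sum_mul, e.sum_inner_mul_inner, e.norm_eq_one, one_pow, mul_one,
    Finset.sum_const, Finset.card_univ, nsmul_eq_mul, e.sum_sq_inner_left] at h5
  simp only [← hq, real_inner_self_eq_norm_sq, real_inner_comm x p, real_inner_comm p q]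
    at h1 h2 h3 h4 hH
  have hw : 0 < b ^ 2 - u x ^ 2 := by nlinarith [sq_nonneg (u x)]
  generalize ∑ i, ‖fderiv ℝ (gradient u) x (e i)‖ ^ 2 = SA at *
  generalize ∑ i, ⟪p, fderiv ℝ (fderiv ℝ (gradient u)) x (e i) (e i)⟫ = ST at *
  generalize ∑ i, ⟪fderiv ℝ (gradient u) x (e i), e i⟫ = D at *
  generalize ⟪p, fderiv ℝ (fderiv ℝ (gradient u)) x p p⟫ = T at *
  generalize ⟪x, q⟫ = α at *
  generalize ⟪p, q⟫ = β at *
  generalize ⟪x, p⟫ = y at *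
  generalize ‖q‖ ^ 2 = N at *
  generalize ‖p‖ ^ 2 = G at *
  generalize (Fintype.card ι : ℝ) = m at *
  obtain ⟨φ, hφ⟩ : ∃ φ, φ = a ^ 2 - ‖x‖ ^ 2 := ⟨_, rfl⟩
  have hcard : m * a ^ 2 - m * ‖x‖ ^ 2 = m * φ := by rw [hφ]; ring
  rw [hcard] at h5
  simp only [← hφ] at hx hM h1 h2 h3 h4 h5 ⊢
  clear hcond hmax hsymm
  have hR : 0 ≤ ‖x‖ ^ 2 := sq_nonneg _
  generalize ‖x‖ ^ 2 = R at *
  generalize u x = U at *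
  obtain ⟨s, hs⟩ : ∃ s, s = φ * U / (b ^ 2 - U ^ 2) := ⟨_, rfl⟩
  have hs' : s * (b ^ 2 - U ^ 2) = φ * U := by rw [hs]; field_simp
  have hM' : M = φ ^ 2 / (b ^ 2 - U ^ 2) * G := by
    rw [div_mul_eq_mul_div, eq_div_iff hw.ne', hM]
  have hMU : M * U = s * φ * G := by rw [hM', hs]; ring
  have hα : φ * α = G * (2 * R - s * y) := by
    refine mul_left_cancel₀ (mul_pos two_pos hx).ne' ?_
    linear_combination h1 - 2 * y * hMU
  have hβ : φ * β = G * (2 * y - s * G) := by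
    refine mul_left_cancel₀ (mul_pos two_pos hx).ne' ?_
    linear_combination h2 - 2 * G * hMU
  have hN : φ ^ 2 * N = G ^ 2 * (4 * R - 4 * s * y + s ^ 2 * G) := by
    linear_combination h3 / 2 - β * hMU + 2 * G * hα - s * G * hβ
  refine gradient_bound_absorption (y := y) hb hub hx hE hy hR hs' ?_
  refine nonpos_of_mul_nonpos_right ?_ hE
  have hSA : 0 ≤ φ ^ 2 * SA := by positivity
  have hD : 2 * M * U * (D + β) = 0 := by rw [hH, mul_zero]
  have hsum : (8 * R + 8 * y ^ 2 - 4 * φ * m - 4 * φ * G) * G - 16 * (φ * α) - 16 * y * (φ * β)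
      - 2 * (φ ^ 2 * N) + 2 * M * (G + G ^ 2) ≤ 0 := by
    have hT' : φ ^ 2 * (ST + T) = φ ^ 2 * (-2 * N) := by rw [hT]
    linarith
  rw [hα, hβ, hN, hM'] at hsum
  linarith

end Basis

end Gradient

/-- Interior gradient estimate (flat instance): for a smooth exponentially
harmonic `u` with `3u² < b²`, there is `C > 0` with
`(a² − ‖x‖²)² ‖∇u(x)‖² ≤ C (b² − u(x)²) a^{7/2}` for all `a ≥ 1`, `‖x‖ ≤ a`. -/
theorem stmt_13 {n : ℕ} (u : EuclideanSpace ℝ (Fin n) → ℝ) (hu : ContDiff ℝ (⊤ : ℕ∞) u)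
    (hharm : ∀ x, lap u x + Hess u x (gradient u x) (gradient u x) = 0)
    (b : ℝ) (hb : 0 < b) (hub : ∀ x, 3 * u x ^ 2 < b ^ 2) :
    ∃ C : ℝ, 0 < C ∧ ∀ a : ℝ, 1 ≤ a → ∀ x : EuclideanSpace ℝ (Fin n), ‖x‖ ≤ a →
      (a ^ 2 - ‖x‖ ^ 2) ^ 2 * ‖gradient u x‖ ^ 2
        ≤ C * (b ^ 2 - u x ^ 2) * a ^ ((7 : ℝ) / 2) := by
  have hw : ∀ x, 2 * b ^ 2 / 3 ≤ b ^ 2 - u x ^ 2 := fun x => by linarith [hub x]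
  have hw0 : ∀ x, 0 < b ^ 2 - u x ^ 2 := fun x =>
    lt_of_lt_of_le (by positivity) (hw x)
  set K : ℝ := 1 + 3 * b ^ 2 * (400 + 4 * n) with hK
  have hK0 : 0 < K := by positivity
  refine ⟨K * (3 / (2 * b ^ 2)), by positivity, fun a ha x hxa => ?_⟩
  have hharm' : ∀ x, ∑ i, ⟪fderiv ℝ (gradient u) x (EuclideanSpace.basisFun (Fin n) ℝ i),
      EuclideanSpace.basisFun (Fin n) ℝ i⟫
      + ⟪fderiv ℝ (gradient u) x (gradient u x), gradient u x⟫ = 0 := fun x => by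
    simpa only [inner_fderiv_gradient hu, lap, Hess] using hharm x
  let H : EuclideanSpace ℝ (Fin n) → ℝ := fun y =>
    (a ^ 2 - ‖y‖ ^ 2) ^ 2 * ‖gradient u y‖ ^ 2 / (b ^ 2 - u y ^ 2)
  have hH : Continuous H := by
    have hGc : Continuous (gradient u) := hu.gradient_top.continuous
    have huc : Continuous u := hu.continuous
    exact Continuous.div (by fun_prop) (by fun_prop) fun y => (hw0 y).ne'
  obtain ⟨z, hz, hzmax⟩ := (isCompact_closedBall (0 : EuclideanSpace ℝ (Fin n)) a).exists_isMaxOn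
    ⟨0, Metric.mem_closedBall_self (by linarith)⟩ hH.continuousOn
  have hza : ‖z‖ ≤ a := by simpa using hz
  have hsub : 0 ≤ a ^ 2 - ‖z‖ ^ 2 := by nlinarith [norm_nonneg z]
  have hbound : (a ^ 2 - ‖z‖ ^ 2) ^ 2 * ‖gradient u z‖ ^ 2 ≤ K * a ^ 3 := by
    rcases hsub.eq_or_lt with h0 | hpos
    · rw [← h0]
      have : 0 ≤ K * a ^ 3 := by positivity
      simpa using this
    rcases (norm_nonneg (gradient u z)).eq_or_lt with h0 | hgrad
    · rw [← h0]
      have : 0 ≤ K * a ^ 3 := by positivity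
      simpa using this
    have hlt : ‖z‖ < a := by nlinarith [norm_nonneg z]
    have hM : H z * (b ^ 2 - u z ^ 2) = (a ^ 2 - ‖z‖ ^ 2) ^ 2 * ‖gradient u z‖ ^ 2 :=
      div_mul_cancel₀ _ (hw0 z).ne'
    have hmax : IsLocalMax (fun y => (a ^ 2 - ‖y‖ ^ 2) ^ 2 * ‖gradient u y‖ ^ 2
        - H z * (b ^ 2 - u y ^ 2)) z := by
      filter_upwards [Metric.isOpen_ball.mem_nhds (show z ∈ Metric.ball 0 a by simpa using hlt)]
        with y hy
      have hle : H y ≤ H z := hzmax (Metric.ball_subset_closedBall hy)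
      have := (div_le_iff₀ (hw0 y)).1 hle
      linarith
    have hest := gradient_bound_of_isLocalMax (EuclideanSpace.basisFun (Fin n) ℝ) hu hharm' hb
      (hub z) hpos hgrad hM hmax
    rw [Fintype.card_fin] at hest
    exact cutoff_gradient_growth ha n.cast_nonneg hsub (sq_nonneg _) (sq_nonneg _) (by ring) hest
  have hHx : H x ≤ H z := hzmax (by simpa using hxa)
  have hHz : H z ≤ K * (3 / (2 * b ^ 2)) * a ^ 3 := by
    rw [div_le_iff₀ (hw0 z)]
    calc (a ^ 2 - ‖z‖ ^ 2) ^ 2 * ‖gradient u z‖ ^ 2 ≤ K * a ^ 3 := hbound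
      _ = K * (3 / (2 * b ^ 2)) * a ^ 3 * (2 * b ^ 2 / 3) := by field_simp
      _ ≤ K * (3 / (2 * b ^ 2)) * a ^ 3 * (b ^ 2 - u z ^ 2) := by
        gcongr
        exact hw z
  have hpow : a ^ 3 ≤ a ^ ((7 : ℝ) / 2) := by
    rw [← Real.rpow_natCast]
    exact Real.rpow_le_rpow_of_exponent_le ha (by norm_num)
  calc (a ^ 2 - ‖x‖ ^ 2) ^ 2 * ‖gradient u x‖ ^ 2 = H x * (b ^ 2 - u x ^ 2) :=
        (div_mul_cancel₀ _ (hw0 x).ne').symm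
    _ ≤ K * (3 / (2 * b ^ 2)) * a ^ ((7 : ℝ) / 2) * (b ^ 2 - u x ^ 2) := by
      refine mul_le_mul_of_nonneg_right (hHx.trans (hHz.trans ?_)) (hw0 x).le
      gcongr
    _ = K * (3 / (2 * b ^ 2)) * (b ^ 2 - u x ^ 2) * a ^ ((7 : ℝ) / 2) := by ring
end
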